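/- Let R be a commutative ring with identity and M a comorphic R-module. Consider the conditions: (a) M satisfies the ascending chain condition on completely irreducible submodules; (b) R satisfies the ascending chain condition on the set of ideals {(L :_R M) : L a completely irreducible submodule of M}; (c) M satisfies the ascending chain condition on submodules N with M/N finitely cogenerated; (d) R satisfies the ascending chain condition on the set of ideals {(N :_R M) : N a submodule with M/N finitely cogenerated}. Then (a) ⇔ (b), (c) ⇔ (d), and (c) ⇒ (a). -/

import Mathlib

open Pointwise

/-- A proper submodule `L` of a module is completely irreducible if whenever `L` is the
intersection of a family of submodules, it equals one of them. -/
def CompletelyIrreducible {R M : Type*} [CommRing R] [AddCommGroup M] [Module R M]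
    (L : Submodule R M) : Prop :=
  L ≠ ⊤ ∧ ∀ S : Set (Submodule R M), L = sInf S → L ∈ S

/-- `M` is a comorphic `R`-module if every completely irreducible submodule `L`
satisfies `L = aM` and `(L :_R M) = Ra + Ann_R(M)` for some `a ∈ R`. -/
def Comorphic (R M : Type*) [CommRing R] [AddCommGroup M] [Module R M] : Prop :=
  ∀ L : Submodule R M, CompletelyIrreducible L →
    ∃ a : R, L = a • (⊤ : Submodule R M) ∧
      L.colon ⊤ = Ideal.span {a} + (⊤ : Submodule R M).annihilator

/-- An `R`-module `X` is finitely cogenerated if every family of submodules with zero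
intersection admits a finite subfamily with zero intersection. -/
def FinitelyCogenerated (R X : Type*) [CommRing R] [AddCommGroup X] [Module R X] : Prop :=
  ∀ S : Set (Submodule R X), sInf S = ⊥ →
    ∃ T : Finset (Submodule R X), ↑T ⊆ S ∧ T.inf id = ⊥

/-- A partially ordered type satisfies the ascending chain condition on elements
satisfying `P` if every ascending chain of such elements stabilizes. -/
def ACCOn {α : Type*} [Preorder α] (P : α → Prop) : Prop :=
  ∀ f : ℕ →o α, (∀ n, P (f n)) → ∃ n, ∀ m, n ≤ m → f m = f n

section Helpers

variable {R M : Type*} [CommRing R] [AddCommGroup M] [Module R M]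

theorem completelyIrreducible_iff_exists_mem_of_lt {L : Submodule R M} :
    CompletelyIrreducible L ↔ ∃ x ∉ L, ∀ K, L < K → x ∈ K := by
  constructor
  · rintro ⟨-, h⟩
    have hne : L ≠ sInf (Set.Ioi L) := fun e => lt_irrefl L (h _ e)
    have hlt : L < sInf (Set.Ioi L) := lt_of_le_of_ne (le_sInf fun K hK => le_of_lt hK) hne
    obtain ⟨x, hx, hxL⟩ := SetLike.exists_of_lt hlt
    exact ⟨x, hxL, fun K hK => Submodule.mem_sInf.1 hx K hK⟩
  · rintro ⟨x, hxL, h⟩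
    refine ⟨fun e => hxL (e ▸ Submodule.mem_top), fun S hS => ?_⟩
    by_contra hLS
    apply hxL
    rw [hS, Submodule.mem_sInf]
    intro K hK
    refine h K (lt_of_le_of_ne (hS ▸ sInf_le hK) ?_)
    rintro rfl
    exact hLS hK

theorem CompletelyIrreducible.comap {L : Submodule R M} (hL : CompletelyIrreducible L)
    (f : M →ₗ[R] M) (hf : L.comap f ≠ ⊤) : CompletelyIrreducible (L.comap f) := by
  rw [completelyIrreducible_iff_exists_mem_of_lt] at hL ⊢
  obtain ⟨x, hxL, hx⟩ := hL
  have key : ∀ K, L.comap f < K → ∃ k ∈ K, x - f k ∈ L := by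
    intro K hK
    obtain ⟨k, hkK, hkL⟩ := SetLike.exists_of_lt hK
    have hlt : L < K.map f ⊔ L := by
      refine lt_of_le_of_ne le_sup_right fun e => hkL ?_
      rw [Submodule.mem_comap, e]
      exact Submodule.mem_sup_left (Submodule.mem_map_of_mem hkK)
    obtain ⟨_, ⟨y, hy, rfl⟩, l, hl, rfl⟩ := Submodule.mem_sup.1 (hx _ hlt)
    exact ⟨y, hy, by simpa using hl⟩
  obtain ⟨m, -, hm⟩ := key ⊤ (lt_top_iff_ne_top.2 hf)
  refine ⟨m, fun h => hxL ?_, fun K hK => ?_⟩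
  · simpa using L.add_mem hm h
  · obtain ⟨k, hkK, hk⟩ := key K hK
    have hmk : m - k ∈ L.comap f := by
      simpa using L.sub_mem hk hm
    simpa using K.add_mem (hK.le hmk) hkK

theorem exists_completelyIrreducible_of_notMem {N : Submodule R M} {x : M} (hx : x ∉ N) :
    ∃ L, N ≤ L ∧ x ∉ L ∧ CompletelyIrreducible L := by
  obtain ⟨L, hNL, hL⟩ := zorn_le_nonempty₀ {K : Submodule R M | x ∉ K}
    (fun c hc hchain y hy => ⟨sSup c, fun hmem => by
      obtain ⟨K, hK, hxK⟩ :=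
        (Submodule.mem_sSup_of_directed ⟨y, hy⟩ hchain.directedOn).1 hmem
      exact hc hK hxK, fun _ => le_sSup⟩) N hx
  refine ⟨L, hNL, hL.prop, completelyIrreducible_iff_exists_mem_of_lt.2
    ⟨x, hL.prop, fun K hK => ?_⟩⟩
  by_contra hxK
  exact hL.not_prop_of_gt hK hxK

theorem FinitelyCogenerated.exists_finset_inf {N : Submodule R M}
    (hN : FinitelyCogenerated R (M ⧸ N)) :
    ∃ T : Finset (Submodule R M), (∀ L ∈ T, CompletelyIrreducible L) ∧ T.inf id = N := by
  classical
  obtain ⟨T, hTS, hT⟩ :=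
    hN {K | CompletelyIrreducible (K.comap N.mkQ)} (by
      rw [eq_bot_iff]
      intro y hy
      obtain ⟨x, rfl⟩ := N.mkQ_surjective y
      by_contra hne
      have hxN : x ∉ N := by simpa using hne
      obtain ⟨L, hNL, hxL, hL⟩ := exists_completelyIrreducible_of_notMem hxN
      have hcomap : (L.map N.mkQ).comap N.mkQ = L := by
        rw [Submodule.comap_map_mkQ, sup_eq_right.2 hNL]
      have hmem := Submodule.mem_sInf.1 hy (L.map N.mkQ) (by
        rwa [Set.mem_ofPred_eq, hcomap])
      rw [← Submodule.mem_comap, hcomap] at hmem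
      exact hxL hmem)
  refine ⟨T.image (Submodule.comap N.mkQ), ?_, ?_⟩
  · simp only [Finset.mem_image]
    rintro _ ⟨K, hK, rfl⟩
    exact hTS hK
  · ext x
    have hx : N.mkQ x ∈ T.inf id ↔ x ∈ N := by rw [hT]; simp
    rw [← hx]
    simp [Submodule.mem_finsetInf]

theorem CompletelyIrreducible.finitelyCogenerated_quotient {L : Submodule R M}
    (hL : CompletelyIrreducible L) : FinitelyCogenerated R (M ⧸ L) := by
  intro S hS
  obtain ⟨K, hK, hKL⟩ := hL.2 (Submodule.comap L.mkQ '' S) (by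
    ext x
    have hx : L.mkQ x ∈ sInf S ↔ x ∈ L := by rw [hS]; simp
    rw [← hx]
    simp [Submodule.mem_sInf])
  refine ⟨{K}, by simpa using hK, ?_⟩
  rw [Finset.inf_singleton, id, ← Submodule.map_comap_eq_of_surjective L.mkQ_surjective K, hKL,
    Submodule.mkQ_map_self]

theorem inf_smul_top (d : R) (L : Submodule R M) :
    L ⊓ d • (⊤ : Submodule R M) = d • L.comap (LinearMap.lsmul R M d) := by
  ext x
  simp only [Submodule.mem_inf, Submodule.mem_smul_pointwise_iff_exists, Submodule.mem_comap,
    LinearMap.lsmul_apply, Submodule.mem_top, true_and]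
  constructor
  · rintro ⟨hx, m, rfl⟩
    exact ⟨m, hx, rfl⟩
  · rintro ⟨m, hm, rfl⟩
    exact ⟨hm, m, rfl⟩

theorem Comorphic.exists_finset_inf_eq_smul_top (hM : Comorphic R M)
    (T : Finset (Submodule R M)) (hT : ∀ L ∈ T, CompletelyIrreducible L) :
    ∃ d : R, T.inf id = d • (⊤ : Submodule R M) := by
  classical
  induction T using Finset.induction_on with
  | empty => exact ⟨1, by simp⟩
  | insert L T _ ih =>
    obtain ⟨d, hd⟩ := ih fun K hK => hT K (Finset.mem_insert_of_mem hK)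
    rw [Finset.inf_insert, hd, id, inf_smul_top]
    by_cases h : L.comap (LinearMap.lsmul R M d) = ⊤
    · exact ⟨d, by rw [h]⟩
    · obtain ⟨c, hc, -⟩ := hM _ ((hT L (Finset.mem_insert_self L T)).comap _ h)
      exact ⟨d * c, by rw [hc, mul_smul]⟩

theorem Comorphic.exists_eq_smul_top (hM : Comorphic R M) {N : Submodule R M}
    (hN : FinitelyCogenerated R (M ⧸ N)) : ∃ d : R, N = d • (⊤ : Submodule R M) := by
  obtain ⟨T, hT, rfl⟩ := hN.exists_finset_inf
  exact hM.exists_finset_inf_eq_smul_top T hT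

theorem colon_top_smul_top_of_eq_smul_top {N : Submodule R M} {d : R}
    (hN : N = d • (⊤ : Submodule R M)) : N.colon ⊤ • (⊤ : Submodule R M) = N := by
  apply le_antisymm
  · exact Submodule.smul_le.2 fun r hr m _ => Submodule.mem_colon.1 hr m trivial
  · intro x hx
    have hd : d ∈ N.colon ⊤ := Submodule.mem_colon.2 fun m _ => by
      rw [hN]
      exact Submodule.smul_mem_pointwise_smul m d ⊤ trivial
    rw [hN] at hx
    obtain ⟨m, -, rfl⟩ := (Submodule.mem_smul_pointwise_iff_exists _ _ _).1 hx
    exact Submodule.smul_mem_smul hd trivial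

theorem accOn_iff_accOn_colon {P : Submodule R M → Prop}
    (hP : ∀ N, P N → N.colon ⊤ • (⊤ : Submodule R M) = N) :
    ACCOn P ↔ ACCOn (fun I : Ideal R => ∃ N, P N ∧ I = N.colon ⊤) := by
  constructor
  · intro h f hf
    choose N hN hfN using hf
    have hNf : ∀ n, N n = f n • (⊤ : Submodule R M) := fun n => by rw [hfN, hP _ (hN n)]
    obtain ⟨n, hn⟩ := h ⟨N, fun i j hij => by
      rw [hNf, hNf]
      exact Submodule.smul_mono_left (f.monotone hij)⟩ hN
    refine ⟨n, fun m hm => ?_⟩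
    rw [hfN, hfN]
    exact congrArg (fun K : Submodule R M => K.colon ⊤) (hn m hm)
  · intro h f hf
    obtain ⟨n, hn⟩ := h ⟨fun i => (f i).colon ⊤, fun i j hij =>
      Submodule.colon_mono (f.monotone hij) le_rfl⟩ fun i => ⟨f i, hf i, rfl⟩
    refine ⟨n, fun m hm => ?_⟩
    rw [← hP _ (hf m), ← hP _ (hf n)]
    exact congrArg (fun I : Ideal R => I • (⊤ : Submodule R M)) (hn m hm)

end Helpers

theorem comorphic_acc_conditions {R M : Type*} [CommRing R] [AddCommGroup M] [Module R M]
    (hM : Comorphic R M) :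
    (ACCOn (fun L : Submodule R M => CompletelyIrreducible L) ↔
      ACCOn (fun I : Ideal R =>
        ∃ L : Submodule R M, CompletelyIrreducible L ∧ I = L.colon ⊤)) ∧
    (ACCOn (fun N : Submodule R M => FinitelyCogenerated R (M ⧸ N)) ↔
      ACCOn (fun I : Ideal R =>
        ∃ N : Submodule R M, FinitelyCogenerated R (M ⧸ N) ∧ I = N.colon ⊤)) ∧
    (ACCOn (fun N : Submodule R M => FinitelyCogenerated R (M ⧸ N)) →
      ACCOn (fun L : Submodule R M => CompletelyIrreducible L)) := by
  have hFC : ∀ N : Submodule R M, FinitelyCogenerated R (M ⧸ N) →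
      N.colon ⊤ • (⊤ : Submodule R M) = N := fun N hN => by
    obtain ⟨d, hd⟩ := hM.exists_eq_smul_top hN
    exact colon_top_smul_top_of_eq_smul_top hd
  exact ⟨accOn_iff_accOn_colon fun L hL => hFC L hL.finitelyCogenerated_quotient,
    accOn_iff_accOn_colon hFC, fun h f hf => h f fun n => (hf n).finitelyCogenerated_quotient⟩
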